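/- arXiv:1412.6365 — 2 statements merged into one kernel-verified Lean document; each statement's English description precedes it below -/
import Mathlib

section
/- Let g' ≥ 0 and r ≥ 0 be integers and m₁, …, m_r ≥ 2 be integers, and set Θ := 2g' − 2 + Σ_{i=1}^r (m_i − 1)/m_i ∈ ℚ. If Θ > 0, then Θ ≥ f(g'), where f(0) = 1/42, f(1) = 1/2, and f(g') = 2g' − 2 for g' ≥ 2. -/
/-- Monotonicity of reciprocals of natural numbers, cast to `ℚ`. -/
lemma inv_natCast_le_inv_natCast {k n : ℕ} (hk : 0 < k) (h : k ≤ n) :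
    (n : ℚ)⁻¹ ≤ (k : ℚ)⁻¹ :=
  inv_anti₀ (by exact_mod_cast hk) (by exact_mod_cast h)

/-- Three ordered unit fractions with sum less than `1` have sum at most `41/42`. -/
lemma inv_add_inv_add_inv_le_of_sorted {a b c : ℕ} (ha : 2 ≤ a) (hab : a ≤ b) (hbc : b ≤ c)
    (h : (a : ℚ)⁻¹ + (b : ℚ)⁻¹ + (c : ℚ)⁻¹ < 1) :
    (a : ℚ)⁻¹ + (b : ℚ)⁻¹ + (c : ℚ)⁻¹ ≤ 41 / 42 := by
  have le {k n : ℕ} (hk : 0 < k) (hkn : k ≤ n) := inv_natCast_le_inv_natCast hk hkn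
  have hc : 0 < (c : ℚ)⁻¹ := by
    have : 0 < c := by omega
    positivity
  rcases (by omega : a = 2 ∨ a = 3 ∨ 4 ≤ a) with rfl | rfl | h4
  · rcases (by omega : b = 2 ∨ b = 3 ∨ b = 4 ∨ 5 ≤ b) with rfl | rfl | rfl | h5
    · norm_num at h
      linarith
    · rcases Nat.lt_or_ge c 7 with h7 | h7
      · have := le (by omega) (by omega : c ≤ 6)
        norm_num at h this
        linarith
      · have := le (by omega) h7
        norm_num at this ⊢
        linarith
    · rcases Nat.lt_or_ge c 5 with h5 | h5
      · have := le (by omega) (by omega : c ≤ 4)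
        norm_num at h this
        linarith
      · have := le (by omega) h5
        norm_num at this ⊢
        linarith
    · have h₁ := le (by omega) h5
      have h₂ := le (by omega) (h5.trans hbc)
      norm_num at h₁ h₂ ⊢
      linarith
  · rcases Nat.lt_or_ge c 4 with h4 | h4
    · obtain rfl : b = 3 := by omega
      obtain rfl : c = 3 := by omega
      norm_num at h
    · have h₁ := le (by omega) hab
      have h₂ := le (by omega) h4
      norm_num at h₁ h₂ ⊢
      linarith
  · have h₁ := le (by omega) h4
    have h₂ := le (by omega) (h4.trans hab)
    have h₃ := le (by omega) (h4.trans (hab.trans hbc))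
    norm_num at h₁ h₂ h₃ ⊢
    linarith

/-- Three unit fractions, none equal to `1`, with sum less than `1` have sum at most `41/42`. -/
lemma inv_add_inv_add_inv_le {a b c : ℕ} (ha : 2 ≤ a) (hb : 2 ≤ b) (hc : 2 ≤ c)
    (h : (a : ℚ)⁻¹ + (b : ℚ)⁻¹ + (c : ℚ)⁻¹ < 1) :
    (a : ℚ)⁻¹ + (b : ℚ)⁻¹ + (c : ℚ)⁻¹ ≤ 41 / 42 := by
  rcases le_total a b with hab | hab <;> rcases le_total b c with hbc | hbc <;>
    rcases le_total a c with hac | hac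
  · exact inv_add_inv_add_inv_le_of_sorted ha hab hbc h
  · exact inv_add_inv_add_inv_le_of_sorted ha hab hbc h
  · linarith [inv_add_inv_add_inv_le_of_sorted ha hac hbc (by linarith)]
  · linarith [inv_add_inv_add_inv_le_of_sorted hc hac hab (by linarith)]
  · linarith [inv_add_inv_add_inv_le_of_sorted hb hab hac (by linarith)]
  · linarith [inv_add_inv_add_inv_le_of_sorted hb hbc hac (by linarith)]
  · linarith [inv_add_inv_add_inv_le_of_sorted hc hbc hab (by linarith)]
  · linarith [inv_add_inv_add_inv_le_of_sorted hc hbc hab (by linarith)]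

/-- Four unit fractions, none equal to `1`, with sum less than `2` have sum at most `11/6`. -/
lemma inv_add_inv_add_inv_add_inv_le {a b c d : ℕ} (ha : 2 ≤ a) (hb : 2 ≤ b) (hc : 2 ≤ c)
    (hd : 2 ≤ d) (h : (a : ℚ)⁻¹ + (b : ℚ)⁻¹ + (c : ℚ)⁻¹ + (d : ℚ)⁻¹ < 2) :
    (a : ℚ)⁻¹ + (b : ℚ)⁻¹ + (c : ℚ)⁻¹ + (d : ℚ)⁻¹ ≤ 11 / 6 := by
  have key {n : ℕ} (hn : 2 ≤ n) : (n : ℚ)⁻¹ = 1 / 2 ∨ (n : ℚ)⁻¹ ≤ 1 / 3 := by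
    rcases hn.eq_or_lt with rfl | hn
    · left
      norm_num
    · right
      simpa using inv_natCast_le_inv_natCast (by norm_num) (show 3 ≤ n from hn)
  rcases key ha with h₁ | h₁ <;> rcases key hb with h₂ | h₂ <;>
    rcases key hc with h₃ | h₃ <;> rcases key hd with h₄ | h₄ <;> linarith

/-- For integers `g' ≥ 0`, `r ≥ 0` and `m₁, …, m_r ≥ 2`, set
`Θ := 2g' - 2 + ∑ (mᵢ - 1)/mᵢ ∈ ℚ`.  If `Θ > 0`, then `Θ ≥ f(g')`, where
`f(0) = 1/42`, `f(1) = 1/2` and `f(g') = 2g' - 2` for `g' ≥ 2`. -/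
theorem stmt6 (g' r : ℕ) (m : Fin r → ℕ) (hm : ∀ i, 2 ≤ m i)
    (Θ : ℚ) (hΘ : Θ = 2 * (g' : ℚ) - 2 + ∑ i, ((m i : ℚ) - 1) / (m i))
    (hpos : 0 < Θ) :
    Θ ≥ (if g' = 0 then (1 / 42 : ℚ) else if g' = 1 then 1 / 2 else 2 * (g' : ℚ) - 2) := by
  have hterm (i : Fin r) : ((m i : ℚ) - 1) / m i = 1 - (m i : ℚ)⁻¹ := by
    have : (m i : ℚ) ≠ 0 := by
      have := hm i
      positivity
    field_simp
  have hhalf (i : Fin r) : (1 / 2 : ℚ) ≤ 1 - (m i : ℚ)⁻¹ := by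
    have := inv_natCast_le_inv_natCast (by norm_num) (hm i)
    norm_num at this ⊢
    linarith
  have hlt (i : Fin r) : 1 - (m i : ℚ)⁻¹ < 1 := by
    have := hm i
    have : 0 < (m i : ℚ)⁻¹ := by positivity
    linarith
  simp only [hterm] at hΘ
  have hsum : (r : ℚ) * (1 / 2) ≤ ∑ i, (1 - (m i : ℚ)⁻¹) := by
    simpa using Finset.card_nsmul_le_sum Finset.univ _ _ fun i _ => hhalf i
  have hr : (0 : ℚ) ≤ r := Nat.cast_nonneg r
  split_ifs with h0 h1
  · subst h0
    rcases Nat.lt_or_ge r 5 with h5 | h5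
    · interval_cases r
      · norm_num at hΘ
        linarith
      · simp only [Fin.sum_univ_succ, Fin.sum_univ_zero] at hΘ
        norm_num at hΘ
        linarith [hlt 0]
      · simp only [Fin.sum_univ_two] at hΘ
        norm_num at hΘ
        linarith [hlt 0, hlt 1]
      · simp only [Fin.sum_univ_three] at hΘ
        norm_num at hΘ
        linarith [inv_add_inv_add_inv_le (hm 0) (hm 1) (hm 2) (by linarith)]
      · simp only [Fin.sum_univ_four] at hΘ
        norm_num at hΘ
        linarith [inv_add_inv_add_inv_add_inv_le (hm 0) (hm 1) (hm 2) (hm 3) (by linarith)]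
    · have : (5 : ℚ) ≤ r := by exact_mod_cast h5
      norm_num at hΘ
      norm_num at hsum
      linarith
  · subst h1
    rcases Nat.eq_zero_or_pos r with rfl | hr'
    · norm_num at hΘ
      linarith
    · have : (1 : ℚ) ≤ r := by exact_mod_cast hr'
      rw [hΘ]
      push_cast
      linarith
  · linarith
end

section
/- Let G be a group and let K₁, K₂, K₃ be normal subgroups of G such that K₁ ∩ K₂ ∩ K₃ = {1}. For 1 ≤ i < j ≤ 3 set K_{i,j} := K_i ∩ K_j, and let K := K_{1,2} · K_{1,3} · K_{2,3} be the subgroup generated by the three pairwise intersections. Then K is a normal subgroup of G, and for every pair i ≠ j the images of K_i and K_j under the quotient map G → G/K intersect trivially; equivalently, (K_i · K) ∩ (K_j · K) = K for all 1 ≤ i < j ≤ 3. -/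
/-- An instance of the modular law for normal subgroups. -/
theorem Subgroup.sup_inf_sup_eq_of_normal {G : Type*} [Group G] (A B C : Subgroup G)
    [A.Normal] [B.Normal] [C.Normal] :
    (A ⊔ B ⊓ C) ⊓ (B ⊔ A ⊓ C) = A ⊓ B ⊔ A ⊓ C ⊔ B ⊓ C := by
  apply le_antisymm
  · rintro x ⟨hx₁, hx₂⟩
    obtain ⟨a, ha, b, hb, rfl⟩ := Subgroup.mem_sup_of_normal_left.mp hx₁
    obtain ⟨c, hc, d, hd, h⟩ := Subgroup.mem_sup_of_normal_left.mp hx₂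
    have hcb : c * b⁻¹ = a * (b * d⁻¹ * b⁻¹) := by
      rw [eq_mul_inv_of_mul_eq h]
      group
    have hA : c * b⁻¹ ∈ A := by
      rw [hcb]
      exact A.mul_mem ha (Subgroup.Normal.conj_mem inferInstance _ (A.inv_mem hd.1) b)
    have hB : c * b⁻¹ ∈ B := B.mul_mem hc (B.inv_mem hb.1)
    have hx : a * b = c * b⁻¹ * b * d := by rw [← h]; group
    rw [hx]
    exact mul_mem (mul_mem (Subgroup.mem_sup_left (Subgroup.mem_sup_left ⟨hA, hB⟩))
      (Subgroup.mem_sup_right hb)) (Subgroup.mem_sup_left (Subgroup.mem_sup_right hd))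
  · refine sup_le (sup_le ?_ ?_) ?_
    · exact inf_le_inf le_sup_left le_sup_left
    · exact le_inf (inf_le_left.trans le_sup_left) le_sup_right
    · exact le_inf le_sup_right (inf_le_left.trans le_sup_left)

/-- Normal subgroups `A` and `B` meet trivially modulo the join of the pairwise intersections
of `A`, `B` and a third normal subgroup `C`. -/
theorem Subgroup.sup_inf_sup_pairwise_inf {G : Type*} [Group G] (A B C : Subgroup G)
    [A.Normal] [B.Normal] [C.Normal] :
    (A ⊔ (A ⊓ B ⊔ A ⊓ C ⊔ B ⊓ C)) ⊓ (B ⊔ (A ⊓ B ⊔ A ⊓ C ⊔ B ⊓ C)) =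
      A ⊓ B ⊔ A ⊓ C ⊔ B ⊓ C := by
  have hA : A ⊔ (A ⊓ B ⊔ A ⊓ C ⊔ B ⊓ C) = A ⊔ B ⊓ C := by
    rw [← sup_assoc, ← sup_assoc, sup_inf_self, sup_inf_self]
  have hB : B ⊔ (A ⊓ B ⊔ A ⊓ C ⊔ B ⊓ C) = B ⊔ A ⊓ C := by
    rw [sup_right_comm, ← sup_assoc, ← sup_assoc, inf_comm A B, sup_inf_self, sup_inf_self]
  rw [hA, hB, Subgroup.sup_inf_sup_eq_of_normal]


/-- Let `K₁, K₂, K₃` be normal subgroups of `G` with trivial triple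
intersection, and let `K := (K₁ ⊓ K₂) ⊔ (K₁ ⊓ K₃) ⊔ (K₂ ⊓ K₃)` be the subgroup generated
by the pairwise intersections.  Then `K` is normal in `G` and for all `i ≠ j` the images of
`Kᵢ` and `Kⱼ` in `G ⧸ K` intersect trivially; equivalently `(Kᵢ ⊔ K) ⊓ (Kⱼ ⊔ K) = K`. -/
theorem stmt8 {G : Type*} [Group G] (K₁ K₂ K₃ : Subgroup G)
    [K₁.Normal] [K₂.Normal] [K₃.Normal]
    (htriv : K₁ ⊓ K₂ ⊓ K₃ = ⊥)
    (K : Subgroup G) (hK : K = (K₁ ⊓ K₂) ⊔ (K₁ ⊓ K₃) ⊔ (K₂ ⊓ K₃)) :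
    K.Normal ∧
    (K₁ ⊔ K) ⊓ (K₂ ⊔ K) = K ∧
    (K₁ ⊔ K) ⊓ (K₃ ⊔ K) = K ∧
    (K₂ ⊔ K) ⊓ (K₃ ⊔ K) = K := by
  subst hK
  refine ⟨inferInstance, Subgroup.sup_inf_sup_pairwise_inf K₁ K₂ K₃, ?_, ?_⟩
  · have h := Subgroup.sup_inf_sup_pairwise_inf K₁ K₃ K₂
    rwa [inf_comm K₃ K₂, sup_comm (K₁ ⊓ K₃)] at h
  · have h := Subgroup.sup_inf_sup_pairwise_inf K₂ K₃ K₁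
    rwa [inf_comm K₂ K₁, inf_comm K₃ K₁, sup_comm (K₂ ⊓ K₃), sup_right_comm] at h
end
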